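/- arXiv:1607.07728 — 5 statements merged into one kernel-verified Lean document; each statement's English description precedes it below -/
import Mathlib

section
/- Let E be a Banach space and let U : ℝ → GL(E) be a continuous representation of ℝ on E, i.e. U_0 = id_E, U_{s+t} = U_s ∘ U_t for all s,t ∈ ℝ, each U_t is a continuous linear automorphism of E, and the map ℝ × E → E, (t,v) ↦ U_t(v), is jointly continuous. Then every continuous 1-cocycle α : ℝ → E for U is equivalent to a smooth cocycle: there exists v ∈ E such that the map ℝ → E, t ↦ α(t) + U_t(v) − v, is C^∞. -/
/-- Let `E` be a Banach space and `U : ℝ → GL(E)` a continuous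
representation of `ℝ` on `E` (so `U 0 = id`, `U (s+t) = U s ∘ U t`, and the action map
`(t, v) ↦ U t v` is jointly continuous).  Then every continuous 1-cocycle
`α : ℝ → E` for `U` is equivalent to a smooth cocycle: there is `v ∈ E` such that
`t ↦ α t + U t v - v` is `C^∞`. -/
theorem continuous_cocycle_equivalent_smooth
    {E : Type*} [NormedAddCommGroup E] [NormedSpace ℝ E] [CompleteSpace E]
    (U : ℝ → (E ≃L[ℝ] E))
    (hU0 : ∀ v : E, U 0 v = v)
    (hUadd : ∀ s t : ℝ, ∀ v : E, U (s + t) v = U s (U t v))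
    (hUcont : Continuous fun p : ℝ × E => U p.1 p.2)
    (α : ℝ → E) (hαcont : Continuous α)
    (hαcocycle : ∀ s t : ℝ, U t (α s) = α (s + t) - α t) :
    ∃ v : E, ContDiff ℝ (⊤ : ℕ∞) (fun t => α t + U t v - v) := by
  let φ : ContDiffBump (0 : ℝ) := ⟨1, 2, one_pos, one_lt_two⟩
  let f : ℝ → ℝ := φ.normed MeasureTheory.volume
  have hfc : Continuous f := φ.continuous_normed
  have hfs : HasCompactSupport f := φ.hasCompactSupport_normed
  have hf1 : ∫ s, f s = 1 := φ.integral_normed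
  have hint : ∀ g : ℝ → E, Continuous g → MeasureTheory.Integrable (fun s => f s • g s) :=
    fun g hg => (hfc.smul hg).integrable_of_hasCompactSupport hfs.smul_right
  refine ⟨∫ s, f s • α (-s), ?_⟩
  have hconv : ContDiff ℝ (⊤ : ℕ∞) (MeasureTheory.convolution f α
      (ContinuousLinearMap.lsmul ℝ ℝ) MeasureTheory.volume) :=
    hfs.contDiff_convolution_left _ φ.contDiff_normed hαcont.locallyIntegrable
  have key : ∀ t, α t + U t (∫ s, f s • α (-s)) = MeasureTheory.convolution f α
      (ContinuousLinearMap.lsmul ℝ ℝ) MeasureTheory.volume t := by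
    intro t
    have h1 : U t (∫ s, f s • α (-s)) = ∫ s, (f s • α (t - s) - f s • α t) := by
      rw [← ContinuousLinearEquiv.integral_comp_comm]
      congr 1
      funext s
      rw [map_smul, hαcocycle, smul_sub, neg_add_eq_sub]
    rw [h1, MeasureTheory.integral_sub (hint (fun s => α (t - s)) (by fun_prop))
      (hint (fun _ => α t) continuous_const), integral_smul_const, hf1, one_smul,
      add_sub_cancel]
    rfl
  simp only [key]
  exact hconv.sub contDiff_const
end

section
/- Let E be a Banach space, r > 0, and let f be a C² map from an open subset of E × E containing the set B := {(x,y) : ‖x‖ ≤ r, ‖y‖ ≤ r} into E, such that f(x,0) = x and f(0,y) = y whenever ‖x‖ ≤ r and ‖y‖ ≤ r, and such that for all (x,y) ∈ B and all u = (u₁,u₂), v = (v₁,v₂) ∈ E × E the second derivative satisfies ‖D²f(x,y)(u,v)‖ ≤ (1/r²)(‖u₁‖+‖u₂‖)(‖v₁‖+‖v₂‖). Then for all x, y ∈ E with ‖x‖ ≤ r and ‖y‖ ≤ r one has ‖f(x,y) − x − y‖ ≤ (‖x‖² + ‖y‖²)/r²; in particular ‖f(x,y)‖ ≤ ‖x +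 y‖ + C(‖x‖² + ‖y‖²)/2 with C := 2/r². -/
/-- Let `E` be a Banach space, `r > 0`, and `f` a `C²` map on an open
set containing `B = {(x,y) : ‖x‖ ≤ r, ‖y‖ ≤ r}`, with values in `E`, such that
`f (x, 0) = x` and `f (0, y) = y` for `‖x‖ ≤ r`, `‖y‖ ≤ r`, and such that the second
derivative satisfies `‖D²f(x,y)(u,v)‖ ≤ (1/r²)(‖u₁‖+‖u₂‖)(‖v₁‖+‖v₂‖)` on `B`.
Then `‖f (x,y) - x - y‖ ≤ (‖x‖² + ‖y‖²)/r²` for `‖x‖ ≤ r`, `‖y‖ ≤ r`; in particular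
`‖f (x,y)‖ ≤ ‖x + y‖ + C (‖x‖² + ‖y‖²)/2` with `C = 2/r²`. -/
theorem local_multiplication_taylor_estimate
    {E : Type*} [NormedAddCommGroup E] [NormedSpace ℝ E] [CompleteSpace E]
    (r : ℝ) (hr : 0 < r) (f : E × E → E) (s : Set (E × E)) (hs : IsOpen s)
    (hBs : {p : E × E | ‖p.1‖ ≤ r ∧ ‖p.2‖ ≤ r} ⊆ s)
    (hf : ContDiffOn ℝ 2 f s)
    (hfx : ∀ x : E, ‖x‖ ≤ r → f (x, 0) = x)
    (hfy : ∀ y : E, ‖y‖ ≤ r → f (0, y) = y)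
    (hbound : ∀ p : E × E, ‖p.1‖ ≤ r → ‖p.2‖ ≤ r → ∀ u v : E × E,
      ‖fderiv ℝ (fderiv ℝ f) p u v‖ ≤ (1 / r ^ 2) * (‖u.1‖ + ‖u.2‖) * (‖v.1‖ + ‖v.2‖)) :
    ∀ x y : E, ‖x‖ ≤ r → ‖y‖ ≤ r →
      ‖f (x, y) - x - y‖ ≤ (‖x‖ ^ 2 + ‖y‖ ^ 2) / r ^ 2 ∧
      ‖f (x, y)‖ ≤ ‖x + y‖ + (2 / r ^ 2) * (‖x‖ ^ 2 + ‖y‖ ^ 2) / 2 := by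
  intro x y hx hy
  have hB : ∀ a ∈ Set.Icc (0:ℝ) 1, ∀ z : E, ‖z‖ ≤ r → ‖a • z‖ ≤ r := by
    intro a ha z hz
    rw [norm_smul, Real.norm_eq_abs, abs_of_nonneg ha.1]
    nlinarith [ha.1, ha.2, norm_nonneg z]
  have hd1 : ∀ p : E × E, ‖p.1‖ ≤ r → ‖p.2‖ ≤ r → HasFDerivAt f (fderiv ℝ f p) p := by
    intro p h1 h2
    exact ((hf.contDiffAt (hs.mem_nhds (hBs ⟨h1, h2⟩))).differentiableAt
      (by norm_num)).hasFDerivAt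
  have hd2 : ∀ p : E × E, ‖p.1‖ ≤ r → ‖p.2‖ ≤ r →
      HasFDerivAt (fderiv ℝ f) (fderiv ℝ (fderiv ℝ f) p) p := by
    intro p h1 h2
    have h := (hf.contDiffAt (hs.mem_nhds (hBs ⟨h1, h2⟩))).fderiv_right (m := 1) (by norm_num)
    exact (h.differentiableAt (by norm_num)).hasFDerivAt
  -- inner estimate
  have inner_est : ∀ a ∈ Set.Icc (0:ℝ) 1,
      ‖fderiv ℝ f (a • x, y) (x, 0) - fderiv ℝ f (a • x, 0) (x, 0)‖
        ≤ 1 / r ^ 2 * ‖y‖ * ‖x‖ := by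
    intro a ha
    have key := norm_image_sub_le_of_norm_deriv_le_segment_01'
      (f := fun b : ℝ => fderiv ℝ f (a • x, b • y) (x, 0))
      (f' := fun b : ℝ => fderiv ℝ (fderiv ℝ f) (a • x, b • y) (0, y) (x, 0))
      (C := 1 / r ^ 2 * ‖y‖ * ‖x‖) ?_ ?_
    · simpa using key
    · intro b hb
      have hc : HasDerivAt (fun b : ℝ => (a • x, b • y)) ((0 : E), y) b := by
        have h := (hasDerivAt_id b).smul_const y
        rw [one_smul] at h
        exact (hasDerivAt_const b (a • x)).prodMk h
      have h := (hd2 (a • x, b • y) (hB a ha x hx) (hB b hb y hy)).comp_hasDerivAt b hc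
      have h2 := h.clm_apply (hasDerivAt_const b ((x, 0) : E × E))
      simpa using h2.hasDerivWithinAt
    · intro b hb
      have h := hbound (a • x, b • y) (hB a ha x hx)
        (hB b (Set.Ico_subset_Icc_self hb) y hy) (0, y) (x, 0)
      simpa using h
  have main : ‖f (x, y) - x - y‖ ≤ 1 / r ^ 2 * ‖y‖ * ‖x‖ := by
    have h00 : f (0, 0) = 0 := hfx 0 (by simpa using hr.le)
    have key := norm_image_sub_le_of_norm_deriv_le_segment_01'
      (f := fun a : ℝ => f (a • x, y) - f (a • x, 0))
      (f' := fun a : ℝ => fderiv ℝ f (a • x, y) (x, 0) - fderiv ℝ f (a • x, 0) (x, 0))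
      (C := 1 / r ^ 2 * ‖y‖ * ‖x‖) ?_ ?_
    · simpa only [one_smul, zero_smul, hfx x hx, hfy y hy, h00, sub_zero] using key
    · intro a ha
      have hc : ∀ z : E, HasDerivAt (fun a : ℝ => (a • x, z)) (x, (0 : E)) a := by
        intro z
        have h := (hasDerivAt_id a).smul_const x
        rw [one_smul] at h
        exact h.prodMk (hasDerivAt_const a z)
      have h1 := (hd1 (a • x, y) (hB a ha x hx) hy).comp_hasDerivAt a (hc y)
      have h2 := (hd1 (a • x, 0) (hB a ha x hx) (by simpa using hr.le)).comp_hasDerivAt a (hc 0)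
      exact (h1.sub h2).hasDerivWithinAt
    · intro a ha
      exact inner_est a (Set.Ico_subset_Icc_self ha)
  have first : ‖f (x, y) - x - y‖ ≤ (‖x‖ ^ 2 + ‖y‖ ^ 2) / r ^ 2 := by
    refine main.trans ?_
    have e : 1 / r ^ 2 * ‖y‖ * ‖x‖ = (‖y‖ * ‖x‖) / r ^ 2 := by ring
    rw [e]
    gcongr
    nlinarith [sq_nonneg (‖x‖ - ‖y‖), sq_nonneg (‖x‖ + ‖y‖)]
  refine ⟨first, ?_⟩
  have e : f (x, y) = (x + y) + (f (x, y) - x - y) := by abel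
  have e2 : 2 / r ^ 2 * (‖x‖ ^ 2 + ‖y‖ ^ 2) / 2 = (‖x‖ ^ 2 + ‖y‖ ^ 2) / r ^ 2 := by ring
  rw [e2]
  calc ‖f (x, y)‖ = ‖(x + y) + (f (x, y) - x - y)‖ := by rw [← e]
    _ ≤ ‖x + y‖ + ‖f (x, y) - x - y‖ := norm_add_le _ _
    _ ≤ _ := by gcongr
end

section
/- Let E be a normed space, let C > 0 and r > 0, and let ∗ : E × E → E be an associative binary operation satisfying ‖x ∗ y‖ ≤ ‖x + y‖ + C(‖x‖² + ‖y‖²)/2 for all x, y ∈ E with ‖x‖ ≤ r and ‖y‖ ≤ r. For n ∈ ℕ and ρ > 0 set a_n(ρ) := ((Cρ + 1)^n − 1)/C and a(ρ) := (e^{Cρ} − 1)/C. Let k ∈ ℕ, n = 2^k, and let ρ > 0 satisfy a(ρ) ≤ r. Then for all x₁, …, x_n ∈ E with ‖x_i‖ ≤ ρ/n for each i, one has ‖x₁ ∗ x₂ ∗ ⋯ ∗ x_n‖ ≤ a_n(ρ/n) ≤ a(ρ) ≤ r. -/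
theorem foldl_star_aux {E : Type*} (star : E → E → E)
    (hassoc : ∀ a b c : E, star (star a b) c = star a (star b c)) (l : List E) :
    ∀ a b : E, l.foldl star (star a b) = star a (l.foldl star b) := by
  induction l with
  | nil => intro a b; rfl
  | cons c l ih => intro a b; simp only [List.foldl_cons, hassoc, ih]

theorem norm_foldl_aux {E : Type*} [NormedAddCommGroup E]
    (star : E → E → E) (C r : ℝ) (hC : 0 < C)
    (hassoc : ∀ a b c : E, star (star a b) c = star a (star b c))
    (hbound : ∀ x y : E, ‖x‖ ≤ r → ‖y‖ ≤ r →
      ‖star x y‖ ≤ ‖x + y‖ + C * (‖x‖ ^ 2 + ‖y‖ ^ 2) / 2)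
    (σ : ℝ) (hσ : 0 < σ) (j : ℕ) :
    ((C * σ + 1) ^ (2 ^ j) - 1) / C ≤ r →
    ∀ (x : E) (l : List E), (x :: l).length = 2 ^ j → (∀ y ∈ x :: l, ‖y‖ ≤ σ) →
    ‖l.foldl star x‖ ≤ ((C * σ + 1) ^ (2 ^ j) - 1) / C := by
  induction j with
  | zero =>
    intro _ x l hl hn
    have : l = [] := by simpa using hl
    subst this
    have h : ((C * σ + 1) ^ (2 ^ 0) - 1) / C = σ := by field_simp; ring
    rw [h]
    simpa using hn
  | succ j ih =>
    intro hr x l hl hn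
    set A := ((C * σ + 1) ^ (2 ^ j) - 1) / C with hA
    have hA0 : 0 ≤ A := by
      have : 1 ≤ (C * σ + 1) ^ (2 ^ j) := one_le_pow₀ (by nlinarith [mul_pos hC hσ])
      exact div_nonneg (by linarith) hC.le
    have hrec : ((C * σ + 1) ^ (2 ^ (j + 1)) - 1) / C = 2 * A + C * A ^ 2 := by
      rw [pow_succ 2 j, pow_mul, hA]
      field_simp
      ring
    rw [hrec] at hr ⊢
    have hCA : 0 ≤ C * A ^ 2 := by positivity
    have hAr : A ≤ r := by linarith
    have hpos : 0 < 2 ^ j := by positivity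
    have hlen : l.length + 1 = 2 ^ j + 2 ^ j := by
      rw [← List.length_cons (a := x), hl]; ring
    obtain ⟨y, l2, hd⟩ : ∃ y l2, l.drop (2 ^ j - 1) = y :: l2 := by
      apply List.exists_cons_of_length_pos
      rw [List.length_drop]; omega
    have hsplit : l = l.take (2 ^ j - 1) ++ y :: l2 := by
      rw [← hd, List.take_append_drop]
    have h1 : (l.take (2 ^ j - 1)).length = 2 ^ j - 1 := by
      rw [List.length_take]; omega
    have h2 : (y :: l2).length = 2 ^ j := by
      rw [← hd, List.length_drop]; omega
    generalize l.take (2 ^ j - 1) = l1 at hsplit h1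
    subst hsplit
    have b1 := ih hAr x l1 (by rw [List.length_cons]; omega) (by
      intro z hz; apply hn; simp only [List.mem_cons, List.mem_append] at hz ⊢; tauto)
    have b2 := ih hAr y l2 h2 (by
      intro z hz; apply hn; simp only [List.mem_cons, List.mem_append] at hz ⊢; tauto)
    rw [List.foldl_append, List.foldl_cons, foldl_star_aux star hassoc]
    have hb := hbound _ _ (b1.trans hAr) (b2.trans hAr)
    have ht := norm_add_le (l1.foldl star x) (l2.foldl star y)
    have s1 := pow_le_pow_left₀ (norm_nonneg _) b1 2
    have s2 := pow_le_pow_left₀ (norm_nonneg _) b2 2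
    have := mul_le_mul_of_nonneg_left (add_le_add s1 s2) hC.le
    linarith

/-- Let `E` be a normed space, `C, r > 0`, and `∗` an associative
binary operation on `E` satisfying `‖x ∗ y‖ ≤ ‖x + y‖ + C(‖x‖² + ‖y‖²)/2` for
`‖x‖, ‖y‖ ≤ r`.  With `a_n(ρ) = ((Cρ+1)ⁿ - 1)/C` and `a(ρ) = (e^{Cρ} - 1)/C`, if
`n = 2^k` and `ρ > 0` satisfies `a(ρ) ≤ r`, then for any `n` elements `x₁, …, x_n` of
`E` of norm at most `ρ/n`, the left-to-right product satisfies
`‖x₁ ∗ ⋯ ∗ x_n‖ ≤ a_n(ρ/n) ≤ a(ρ) ≤ r`. -/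
theorem norm_iterated_star_product_le
    {E : Type*} [NormedAddCommGroup E] [NormedSpace ℝ E]
    (star : E → E → E) (C r : ℝ) (hC : 0 < C) (hr : 0 < r)
    (hassoc : ∀ a b c : E, star (star a b) c = star a (star b c))
    (hbound : ∀ x y : E, ‖x‖ ≤ r → ‖y‖ ≤ r →
      ‖star x y‖ ≤ ‖x + y‖ + C * (‖x‖ ^ 2 + ‖y‖ ^ 2) / 2)
    (k : ℕ) (ρ : ℝ) (hρ : 0 < ρ)
    (haρ : (Real.exp (C * ρ) - 1) / C ≤ r)
    (x : E) (l : List E) (hlen : (x :: l).length = 2 ^ k)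
    (hnorm : ∀ y ∈ x :: l, ‖y‖ ≤ ρ / 2 ^ k) :
    ‖l.foldl star x‖ ≤ ((C * (ρ / 2 ^ k) + 1) ^ (2 ^ k) - 1) / C ∧
      ((C * (ρ / 2 ^ k) + 1) ^ (2 ^ k) - 1) / C ≤ (Real.exp (C * ρ) - 1) / C ∧
      (Real.exp (C * ρ) - 1) / C ≤ r := by
  have h2 : ((C * (ρ / 2 ^ k) + 1) ^ (2 ^ k) - 1) / C ≤ (Real.exp (C * ρ) - 1) / C := by
    have h : (C * (ρ / 2 ^ k) + 1) ^ (2 ^ k) ≤ Real.exp (C * ρ) := by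
      have e : Real.exp (C * ρ) = Real.exp (C * (ρ / 2 ^ k)) ^ (2 ^ k) := by
        rw [← Real.exp_nat_mul]
        congr 1
        push_cast
        field_simp
      rw [e]
      exact pow_le_pow_left₀ (by positivity) (Real.add_one_le_exp _) _
    gcongr
  exact ⟨norm_foldl_aux star C r hC hassoc hbound _ (by positivity) k (h2.trans haρ) x l hlen hnorm,
    h2, haρ⟩
end

section
/- Let N and G be groups and let φ : G → Aut(N) be a group homomorphism. Let x₁, x₂ ∈ N and y ∈ G, and set x := x₂·x₁^{-1} and, for each s ∈ ℕ, z_s := ∏_{i=0}^{s-1} φ(y^i)(x₂) (product from left to right in increasing order of i), so that (x₂, y)^s = (z_s, y^s) in N ⋊_φ G. Then for every n ∈ ℕ one has (x₁, y)^{-n} · (x₂, y)^{n} = (∏_{s=1}^{n} φ(y^{-s})(z_s^{-1} · x · z_s), 1_G), where the product over s is taken from left to right in increasing order of s. -/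
theorem sdp_mul_aux {N G : Type*} [Group N] [Group G] (φ : G →* MulAut N)
    (a b : N) (g h : G) :
    (⟨a, g⟩ : N ⋊[φ] G) * ⟨b, h⟩ = ⟨a * φ g b, g * h⟩ := rfl

theorem sdp_pow_aux {N G : Type*} [Group N] [Group G] (φ : G →* MulAut N)
    (x : N) (y : G) (s : ℕ) :
    (⟨x, y⟩ : N ⋊[φ] G) ^ s = ⟨((List.range s).map (fun i => φ (y ^ i) x)).prod, y ^ s⟩ := by
  induction s with
  | zero => ext <;> simp
  | succ k ih =>
    rw [pow_succ, ih, sdp_mul_aux, List.prod_range_succ, pow_succ]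

theorem sdp_conj_aux {N G : Type*} [Group N] [Group G] (φ : G →* MulAut N)
    (z w : N) (g : G) :
    (⟨z, g⟩ : N ⋊[φ] G)⁻¹ * ⟨w, 1⟩ * ⟨z, g⟩ = ⟨φ g⁻¹ (z⁻¹ * w * z), 1⟩ := by
  ext <;> simp [mul_assoc]

theorem sdp_div_aux {N G : Type*} [Group N] [Group G] (φ : G →* MulAut N)
    (x₁ x₂ : N) (y : G) :
    (⟨x₂, y⟩ : N ⋊[φ] G) * (⟨x₁, y⟩)⁻¹ = ⟨x₂ * x₁⁻¹, 1⟩ := by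
  ext <;> simp

/-- Let `φ : G → Aut N` and `x₁, x₂ ∈ N`, `y ∈ G`.  Set
`x := x₂ x₁⁻¹` and `z_s := ∏_{i=0}^{s-1} φ(yⁱ)(x₂)` (so that `(x₂, y)^s = (z_s, y^s)`).
Then for every `n`,
`(x₁, y)^{-n} (x₂, y)^{n} = (∏_{s=1}^{n} φ(y^{-s})(z_s⁻¹ x z_s), 1)`,
all products being taken from left to right in increasing order of the index. -/
theorem semidirectProduct_inv_pow_mul_pow
    {N G : Type*} [Group N] [Group G] (φ : G →* MulAut N)
    (x₁ x₂ : N) (y : G) (n : ℕ) :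
    (⟨x₁, y⟩ : N ⋊[φ] G) ^ (-(n : ℤ)) * (⟨x₂, y⟩ : N ⋊[φ] G) ^ (n : ℤ) =
      ⟨((List.range n).map (fun (s : ℕ) =>
          φ (y ^ (-((s : ℤ) + 1)))
            ((((List.range (s + 1)).map (fun i => φ (y ^ i) x₂)).prod)⁻¹ *
              (x₂ * x₁⁻¹) *
              ((List.range (s + 1)).map (fun i => φ (y ^ i) x₂)).prod))).prod,
        1⟩ := by
  induction n with
  | zero => simp
  | succ k ih =>
    have key : ∀ a b : N ⋊[φ] G, a ^ (-((k + 1 : ℕ) : ℤ)) * b ^ ((k + 1 : ℕ) : ℤ) =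
        (a ^ (-(k : ℤ)) * b ^ (k : ℤ)) * ((b ^ (k + 1))⁻¹ * (b * a⁻¹) * b ^ (k + 1)) := by
      intro a b
      simp only [zpow_neg, zpow_natCast]
      rw [pow_succ' b k, pow_succ' a k]
      group
    have hy : y ^ (-((k : ℤ) + 1)) = (y ^ (k + 1))⁻¹ := by
      rw [zpow_neg]; norm_cast
    rw [key, ih, sdp_div_aux, sdp_pow_aux, sdp_conj_aux]
    conv_rhs => rw [List.prod_range_succ, hy]
    rw [sdp_mul_aux, map_one, MulAut.one_apply, one_mul]
end

section
/- Let λ : ℕ → ℝ, let x = (x_n)_{n∈ℕ} be an element of the Hilbert space ℓ²(ℕ, ℂ), and let t > 0. For each integer m ≥ 1 define w_m : ℕ → ℂ by w_m(n) := m·√t·(1 − e^{i·λ_n·√t/m})·x_n. Then each w_m belongs to ℓ²(ℕ, ℂ), and the sequence (w_m)_{m≥1} converges in ℓ²(ℕ, ℂ) as m → ∞ if and only if ∑_{n∈ℕ} |λ_n·x_n|² < ∞; moreover, when this holds, the limit is the element (−i·t·λ_n·x_n)_{n∈ℕ} of ℓ²(ℕ, ℂ). -/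
theorem aux_memlp_two_iff (f : ℕ → ℂ) :
    Memℓp f 2 ↔ Summable (fun n : ℕ => ‖f n‖ ^ 2) := by
  rw [memℓp_gen_iff (by norm_num)]
  simp

theorem aux_norm_sq (f : lp (fun _ : ℕ => ℂ) 2) : ‖f‖ ^ 2 = ∑' n, ‖f n‖ ^ 2 := by
  have h := lp.norm_rpow_eq_tsum (p := 2) (by norm_num) f
  simpa using h

theorem aux_arg (a s : ℝ) (m : ℕ) :
    Complex.I * (a : ℂ) * (s : ℂ) / ((m + 1 : ℕ) : ℂ)
      = Complex.I * ((a * s / ((m + 1 : ℕ) : ℝ) : ℝ) : ℂ) := by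
  push_cast
  ring

theorem aux_bound_two (a s : ℝ) (m : ℕ) :
    ‖1 - Complex.exp (Complex.I * (a : ℂ) * (s : ℂ) / ((m + 1 : ℕ) : ℂ))‖ ≤ 2 := by
  rw [aux_arg]
  refine (norm_sub_le _ _).trans ?_
  rw [Complex.norm_exp_I_mul_ofReal, norm_one]
  norm_num

theorem aux_bound (a t : ℝ) (ht : 0 < t) (m : ℕ) :
    ‖((m + 1 : ℕ) : ℂ) * (Real.sqrt t : ℂ) *
      (1 - Complex.exp (Complex.I * (a : ℂ) * (Real.sqrt t : ℂ) / ((m + 1 : ℕ) : ℂ)))‖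
      ≤ t * ‖(a : ℂ)‖ := by
  rw [aux_arg, norm_mul, norm_sub_rev]
  have h := Real.norm_exp_I_mul_ofReal_sub_one_le (x := a * √t / ((m + 1 : ℕ) : ℝ))
  have hm : (0 : ℝ) < ((m + 1 : ℕ) : ℝ) := by positivity
  have h1 : ‖((m + 1 : ℕ) : ℂ) * (Real.sqrt t : ℂ)‖ = ((m + 1 : ℕ) : ℝ) * √t := by
    rw [norm_mul, Complex.norm_natCast, Complex.norm_real, Real.norm_of_nonneg (Real.sqrt_nonneg t)]
  rw [h1]
  refine (mul_le_mul_of_nonneg_left h (by positivity)).trans (le_of_eq ?_)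
  rw [norm_div, norm_mul, Real.norm_of_nonneg hm.le, Real.norm_of_nonneg (Real.sqrt_nonneg t),
    Complex.norm_real]
  have h2 := Real.mul_self_sqrt ht.le
  field_simp
  rw [pow_two, h2, mul_comm]

theorem aux_tendsto (a t : ℝ) (ht : 0 < t) :
    Filter.Tendsto (fun m : ℕ => ((m + 1 : ℕ) : ℂ) * (Real.sqrt t : ℂ) *
      (1 - Complex.exp (Complex.I * (a : ℂ) * (Real.sqrt t : ℂ) / ((m + 1 : ℕ) : ℂ))))
      Filter.atTop (nhds (-Complex.I * (t : ℂ) * (a : ℂ))) := by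
  have hd : HasDerivAt (fun z : ℂ => Complex.exp (z * (Complex.I * a * (√t : ℝ))))
      (Complex.I * a * (√t : ℝ)) 0 := by
    have h := ((hasDerivAt_id (0 : ℂ)).mul_const (Complex.I * a * (√t : ℝ))).cexp
    simpa using h
  rw [hasDerivAt_iff_tendsto_slope_zero] at hd
  have hu : Filter.Tendsto (fun m : ℕ => (((m + 1 : ℕ) : ℂ))⁻¹) Filter.atTop
      (nhdsWithin 0 {0}ᶜ) := by
    refine tendsto_nhdsWithin_iff.2 ⟨?_, Filter.Eventually.of_forall fun m => ?_⟩
    · have h := tendsto_one_div_add_atTop_nhds_zero_nat (𝕜 := ℂ)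
      simpa using h
    · simpa using Nat.cast_add_one_ne_zero (R := ℂ) m
  have h := (hd.comp hu).const_mul (-((√t : ℝ) : ℂ))
  have h2 : ((√t : ℝ) : ℂ) * ((√t : ℝ) : ℂ) = (t : ℂ) := by
    rw [← Complex.ofReal_mul, Real.mul_self_sqrt ht.le]
  refine (h.congr fun m => ?_).trans (le_of_eq ?_)
  · simp only [Function.comp, zero_add, zero_mul, Complex.exp_zero, inv_inv, smul_eq_mul]
    rw [show (((m + 1 : ℕ) : ℂ))⁻¹ * (Complex.I * a * (√t : ℝ))
      = Complex.I * (a : ℂ) * (Real.sqrt t : ℂ) / ((m + 1 : ℕ) : ℂ) by ring]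
    ring
  · congr 1
    rw [← h2]
    ring

/-- Let `λ : ℕ → ℝ`, `x ∈ ℓ²(ℕ, ℂ)` and `t > 0`.  For `m ≥ 1` let
`w_m(n) := m √t (1 - e^{i λ_n √t / m}) x_n`.  Then each `w_m` lies in `ℓ²`, the
sequence `(w_m)` converges in `ℓ²` as `m → ∞` iff `∑ |λ_n x_n|² < ∞`, and in that
case the limit is `(-i t λ_n x_n)_n`. -/
theorem lp_commutator_limit_iff_C1_vector
    (lam : ℕ → ℝ) (x : lp (fun _ : ℕ => ℂ) 2) (t : ℝ) (ht : 0 < t) :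
    ∃ hmem : ∀ m : ℕ,
        Memℓp (fun n : ℕ => ((m + 1 : ℕ) : ℂ) * (Real.sqrt t : ℂ) *
          (1 - Complex.exp (Complex.I * (lam n : ℂ) * (Real.sqrt t : ℂ) /
            ((m + 1 : ℕ) : ℂ))) * x n) 2,
      ((∃ wlim : lp (fun _ : ℕ => ℂ) 2,
          Filter.Tendsto (fun m : ℕ => (⟨_, hmem m⟩ : lp (fun _ : ℕ => ℂ) 2))
            Filter.atTop (nhds wlim)) ↔
        Summable (fun n : ℕ => ‖(lam n : ℂ) * x n‖ ^ 2)) ∧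
      (Summable (fun n : ℕ => ‖(lam n : ℂ) * x n‖ ^ 2) →
        ∃ hmem' : Memℓp (fun n : ℕ => -Complex.I * (t : ℂ) * (lam n : ℂ) * x n) 2,
          Filter.Tendsto (fun m : ℕ => (⟨_, hmem m⟩ : lp (fun _ : ℕ => ℂ) 2))
            Filter.atTop (nhds (⟨_, hmem'⟩ : lp (fun _ : ℕ => ℂ) 2))) := by
  have hmem : ∀ m : ℕ,
        Memℓp (fun n : ℕ => ((m + 1 : ℕ) : ℂ) * (Real.sqrt t : ℂ) *
          (1 - Complex.exp (Complex.I * (lam n : ℂ) * (Real.sqrt t : ℂ) /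
            ((m + 1 : ℕ) : ℂ))) * x n) 2 := by
    intro m
    rw [aux_memlp_two_iff]
    have hx := (aux_memlp_two_iff _).1 (lp.memℓp x)
    refine Summable.of_nonneg_of_le (fun n => by positivity) (fun n => ?_)
      (hx.mul_left ((‖((m + 1 : ℕ) : ℂ) * (Real.sqrt t : ℂ)‖ * 2) ^ 2))
    rw [← mul_pow, norm_mul, norm_mul]
    gcongr
    exact aux_bound_two _ _ _
  have hpt : ∀ n : ℕ, Filter.Tendsto (fun m : ℕ => ((m + 1 : ℕ) : ℂ) * (Real.sqrt t : ℂ) *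
          (1 - Complex.exp (Complex.I * (lam n : ℂ) * (Real.sqrt t : ℂ) /
            ((m + 1 : ℕ) : ℂ))) * x n) Filter.atTop
          (nhds (-Complex.I * (t : ℂ) * (lam n : ℂ) * x n)) :=
    fun n => (aux_tendsto (lam n) t ht).mul_const (x n)
  have hnorm : ∀ n : ℕ, ‖-Complex.I * (t : ℂ) * (lam n : ℂ) * x n‖
      = t * ‖(lam n : ℂ) * x n‖ := by
    intro n
    rw [mul_assoc, norm_mul, norm_mul, norm_neg, Complex.norm_I, one_mul, Complex.norm_real,
      Real.norm_of_nonneg ht.le]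
  have hlim : Summable (fun n : ℕ => ‖(lam n : ℂ) * x n‖ ^ 2) →
        ∃ hmem' : Memℓp (fun n : ℕ => -Complex.I * (t : ℂ) * (lam n : ℂ) * x n) 2,
          Filter.Tendsto (fun m : ℕ => (⟨_, hmem m⟩ : lp (fun _ : ℕ => ℂ) 2))
            Filter.atTop (nhds (⟨_, hmem'⟩ : lp (fun _ : ℕ => ℂ) 2)) := by
    intro hs
    have hmem' : Memℓp (fun n : ℕ => -Complex.I * (t : ℂ) * (lam n : ℂ) * x n) 2 := by
      rw [aux_memlp_two_iff]
      simp only [hnorm, mul_pow]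
      exact hs.mul_left _
    refine ⟨hmem', ?_⟩
    rw [tendsto_iff_norm_sub_tendsto_zero]
    have key : Filter.Tendsto (fun m : ℕ => ∑' n : ℕ, ‖((m + 1 : ℕ) : ℂ) * (Real.sqrt t : ℂ) *
          (1 - Complex.exp (Complex.I * (lam n : ℂ) * (Real.sqrt t : ℂ) /
            ((m + 1 : ℕ) : ℂ))) * x n - -Complex.I * (t : ℂ) * (lam n : ℂ) * x n‖ ^ 2)
          Filter.atTop (nhds (∑' _ : ℕ, (0 : ℝ))) := by
      refine tendsto_tsum_of_dominated_convergence (hs.mul_left ((2 * t) ^ 2)) (fun n => ?_)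
        (Filter.Eventually.of_forall fun m n => ?_)
      · have h := (tendsto_iff_norm_sub_tendsto_zero.1 (hpt n)).pow 2
        simpa using h
      · rw [Real.norm_of_nonneg (by positivity), ← mul_pow]
        refine pow_le_pow_left₀ (norm_nonneg _) ?_ 2
        refine (norm_sub_le _ _).trans ?_
        rw [hnorm, norm_mul _ (x n)]
        have hb := mul_le_mul_of_nonneg_right (aux_bound (lam n) t ht m) (norm_nonneg (x n))
        rw [norm_mul (lam n : ℂ)]
        linarith
    rw [tsum_zero] at key
    have k2 := key.sqrt
    rw [Real.sqrt_zero] at k2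
    refine k2.congr fun m => ?_
    rw [Real.sqrt_eq_iff_mul_self_eq (tsum_nonneg fun n => by positivity) (norm_nonneg _),
      ← pow_two, aux_norm_sq]
    rfl
  refine ⟨hmem, ⟨?_, fun hs => ?_⟩, hlim⟩
  · rintro ⟨w, hw⟩
    have hwn : ∀ n : ℕ, w n = -Complex.I * (t : ℂ) * (lam n : ℂ) * x n := by
      intro n
      refine tendsto_nhds_unique ?_ (hpt n)
      rw [tendsto_iff_norm_sub_tendsto_zero] at hw ⊢
      exact squeeze_zero (fun m => norm_nonneg _)
        (fun m => lp.norm_apply_le_norm (by norm_num)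
          ((⟨_, hmem m⟩ : lp (fun _ : ℕ => ℂ) 2) - w) n) hw
    have h := (aux_memlp_two_iff _).1 (lp.memℓp w)
    simp only [hwn, hnorm, mul_pow] at h
    exact (summable_mul_left_iff (by positivity)).1 h
  · obtain ⟨h', hw⟩ := hlim hs
    exact ⟨_, hw⟩
end
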